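/- arXiv:1605.04230 — 2 statements merged into one kernel-verified Lean document; each statement's English description precedes it below -/
import Mathlib

section
/- There exist constants C > 0 and L₀ > 2 such that the following holds: for every L > L₀ and every ε ∈ (0,1), if E ⊆ S is measurable, centered around the origin, |E| = 4πL, and ((−(L−ε), L−ε) × 𝕋) ⊆ E ⊆ ((−(L+ε), L+ε) × 𝕋) up to sets of measure zero, then |F(χ_E) − F(χ_{E₀})| ≤ C·L·ε², where E₀ = [−L,L] × 𝕋. -/
open MeasureTheory Real

noncomputable section

instance : Fact (0 < 2 * π) := ⟨by positivity⟩

/-- The circle `𝕋 = ℝ/(2πℤ)` of circumference `2π`, carrying its Haar measure of mass `2π`. -/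
abbrev Torus : Type := AddCircle (2 * π)

/-- The infinite strip `S = ℝ × 𝕋` with the product of Lebesgue and Haar measure. -/
abbrev Strip : Type := ℝ × Torus

/-- `cos`, well-defined on `𝕋 = ℝ/(2πℤ)`. -/
def cosT : Torus → ℝ := Real.cos_periodic.lift

/-- `sin`, well-defined on `𝕋 = ℝ/(2πℤ)`. -/
def sinT : Torus → ℝ := Real.sin_periodic.lift

/-- The regularized energy `F(χ_E) = ∫_E ∫_E log(cosh(x₁-x₂) - cos(y₁-y₂)) dz dξ`. -/
def Freg (E : Set Strip) : ℝ :=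
  ∫ z in E, ∫ ξ in E, Real.log (Real.cosh (z.1 - ξ.1) - cosT (z.2 - ξ.2))

open scoped ENNReal

lemma cosT_coe (θ : ℝ) : cosT (θ : Torus) = Real.cos θ :=
  Real.cos_periodic.lift_coe θ

lemma continuous_cosT : Continuous cosT :=
  Real.continuous_cos.quotient_lift _

lemma cosT_neg (y : Torus) : cosT (-y) = cosT y := by
  induction y using QuotientAddGroup.induction_on with
  | H θ => exact (cosT_coe (-θ)).trans ((Real.cos_neg θ).trans (cosT_coe θ).symm)

lemma cosT_le_one (y : Torus) : cosT y ≤ 1 := by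
  induction y using QuotientAddGroup.induction_on with
  | H θ => exact (cosT_coe θ).trans_le (Real.cos_le_one θ)

lemma neg_one_le_cosT (y : Torus) : -1 ≤ cosT y := by
  induction y using QuotientAddGroup.induction_on with
  | H θ => exact (Real.neg_one_le_cos θ).trans_eq (cosT_coe θ).symm

/-- The logarithmic kernel `log (cosh x - cos y)` on `ℝ × 𝕋`. -/
def logKernel (x : ℝ) (y : Torus) : ℝ := Real.log (Real.cosh x - cosT y)

lemma measurable_logKernel : Measurable fun p : ℝ × Torus => logKernel p.1 p.2 := by
  have h : Continuous fun p : ℝ × Torus => Real.cosh p.1 - cosT p.2 :=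
    (Real.continuous_cosh.comp continuous_fst).sub (continuous_cosT.comp continuous_snd)
  exact Real.measurable_log.comp h.measurable

lemma logKernel_neg (x : ℝ) (y : Torus) : logKernel (-x) (-y) = logKernel x y := by
  simp [logKernel, cosT_neg]

lemma normSq_circleMap_sub_exp (x θ : ℝ) :
    ‖circleMap 0 1 θ - (Real.exp x : ℂ)‖ ^ 2 = 2 * Real.exp x * (Real.cosh x - Real.cos θ) := by
  have h : circleMap 0 1 θ - (Real.exp x : ℂ)
      = ((Real.cos θ - Real.exp x : ℝ) : ℂ) + (Real.sin θ : ℝ) * Complex.I := by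
    simp only [circleMap, Complex.exp_mul_I]
    push_cast
    ring
  rw [h, ← Complex.normSq_eq_norm_sq, Complex.normSq_add_mul_I, Real.cosh_eq]
  have h1 : Real.exp x * Real.exp (-x) = 1 := by rw [← Real.exp_add]; simp
  linear_combination Real.sin_sq_add_cos_sq θ - h1

lemma log_cosh_sub_cos {x θ : ℝ} (h : Real.cosh x - Real.cos θ ≠ 0) :
    Real.log (Real.cosh x - Real.cos θ)
      = 2 * Real.log ‖circleMap 0 1 θ - (Real.exp x : ℂ)‖ - (x + Real.log 2) := by
  have h1 := congrArg Real.log (normSq_circleMap_sub_exp x θ)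
  rw [Real.log_pow, Real.log_mul (by positivity) h, Real.log_mul (by positivity) (by positivity),
    Real.log_exp, Nat.cast_two] at h1
  linarith

lemma log_cosh_sub_cos_ae (x : ℝ) :
    ∀ᵐ θ : ℝ, θ ∈ Set.Ioc 0 (2 * π) → logKernel x (θ : Torus)
      = 2 * Real.log ‖circleMap 0 1 θ - (Real.exp x : ℂ)‖ - (x + Real.log 2) := by
  filter_upwards [compl_mem_ae_iff.mpr (measure_singleton (2 * π) (μ := volume))] with θ hne hθ
  rw [logKernel, cosT_coe]
  refine log_cosh_sub_cos (ne_of_gt ?_)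
  have h1 : Real.cos θ ≠ 1 := fun hc => by
    have := (Real.cos_eq_one_iff_of_lt_of_lt (by linarith [hθ.1, Real.pi_pos])
      (lt_of_le_of_ne hθ.2 hne)).1 hc
    exact hθ.1.ne' this
  linarith [Real.one_le_cosh x, lt_of_le_of_ne (Real.cos_le_one θ) h1]

lemma intervalIntegrable_log_norm_circleMap_sub (a : ℂ) :
    IntervalIntegrable (fun θ : ℝ => Real.log ‖circleMap 0 1 θ - a‖) volume 0 (2 * π) :=
  circleIntegrable_log_norm_sub_const (a := a) (c := 0) 1

lemma integral_log_norm_circleMap_sub_exp (x : ℝ) :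
    ∫ θ in (0 : ℝ)..2 * π, Real.log ‖circleMap 0 1 θ - (Real.exp x : ℂ)‖ = 2 * π * max 0 x := by
  have h := circleAverage_log_norm_sub_const_eq_posLog (a := (Real.exp x : ℂ))
  rw [Real.circleAverage_def, Complex.norm_real, Real.norm_eq_abs, Real.abs_exp, Real.posLog,
    Real.log_exp, smul_eq_mul] at h
  rw [← h]
  field_simp

lemma integrable_logKernel (x : ℝ) : Integrable (logKernel x) := by
  have hmp := AddCircle.measurePreserving_mk (2 * π) 0
  refine (hmp.integrable_comp
    (measurable_logKernel.comp measurable_prodMk_left).aestronglyMeasurable).1 ?_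
  have h := ((intervalIntegrable_log_norm_circleMap_sub (Real.exp x)).const_mul 2).sub
    (intervalIntegrable_const (c := x + Real.log 2))
  rw [intervalIntegrable_iff_integrableOn_Ioc_of_le (by positivity)] at h
  rw [zero_add]
  refine h.congr ?_
  filter_upwards [(ae_restrict_iff' measurableSet_Ioc).2 (log_cosh_sub_cos_ae x)] with θ hθ
  exact hθ.symm

/-- The kernel integrated over one period of the circle. -/
lemma integral_logKernel (x : ℝ) : ∫ y, logKernel x y = 2 * π * (|x| - Real.log 2) := by
  rw [← AddCircle.intervalIntegral_preimage (2 * π) 0, zero_add,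
    intervalIntegral.integral_congr_ae (g := fun θ : ℝ =>
      2 * Real.log ‖circleMap 0 1 θ - (Real.exp x : ℂ)‖ - (x + Real.log 2)),
    intervalIntegral.integral_sub ((intervalIntegrable_log_norm_circleMap_sub _).const_mul 2)
      intervalIntegrable_const, intervalIntegral.integral_const_mul,
    integral_log_norm_circleMap_sub_exp, intervalIntegral.integral_const, smul_eq_mul]
  · rcases le_total 0 x with h | h
    · rw [max_eq_right h, abs_of_nonneg h]; ring
    · rw [max_eq_left h, abs_of_nonpos h]; ring
  · rw [Set.uIoc_of_le (by positivity)]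
    exact log_cosh_sub_cos_ae x

lemma logKernel_le (x : ℝ) (y : Torus) : logKernel x y ≤ |x| + Real.log 2 := by
  rw [logKernel, ← Real.log_exp |x|, ← Real.log_mul (by positivity) two_ne_zero]
  have h0 : 0 ≤ Real.cosh x - cosT y := by linarith [Real.one_le_cosh x, cosT_le_one y]
  rcases h0.eq_or_lt with h | h
  · rw [← h, Real.log_zero]
    exact Real.log_nonneg (by linarith [Real.one_le_exp (abs_nonneg x)])
  · refine Real.log_le_log h ?_
    have h1 : Real.cosh x ≤ Real.exp |x| := by
      rw [← Real.cosh_abs, Real.cosh_eq]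
      have := Real.exp_le_exp.2 (neg_le_self (abs_nonneg x))
      linarith
    linarith [neg_one_le_cosT y, Real.one_le_exp (abs_nonneg x)]

lemma integral_abs_logKernel_le (x : ℝ) : ∫ y, |logKernel x y| ≤ 2 * π * (|x| + 3) := by
  have hlog : 0 ≤ Real.log 2 := Real.log_nonneg one_le_two
  have h1 : ∫ y, |logKernel x y| ≤ ∫ y, (2 * (|x| + Real.log 2) - logKernel x y) := by
    refine integral_mono (integrable_logKernel x).abs
      ((integrable_const _).sub (integrable_logKernel x)) fun y => ?_
    have := logKernel_le x y
    have := abs_nonneg x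
    exact abs_le.2 ⟨by linarith, by linarith⟩
  rw [integral_sub (integrable_const _) (integrable_logKernel x), integral_logKernel,
    integral_const, measureReal_def, AddCircle.measure_univ,
    ENNReal.toReal_ofReal (by positivity), smul_eq_mul] at h1
  have h2 : Real.log 2 ≤ 1 := by linarith [Real.log_le_sub_one_of_pos (zero_lt_two (α := ℝ))]
  nlinarith [Real.pi_pos]

/-- The interaction kernel of the energy `Freg`. -/
def pairKernel (z ξ : Strip) : ℝ := logKernel (z.1 - ξ.1) (z.2 - ξ.2)

lemma measurable_pairKernel : Measurable fun p : Strip × Strip => pairKernel p.1 p.2 := by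
  have h : Continuous fun p : Strip × Strip =>
      Real.cosh (p.1.1 - p.2.1) - cosT (p.1.2 - p.2.2) :=
    (Real.continuous_cosh.comp (by fun_prop)).sub (continuous_cosT.comp (by fun_prop))
  exact Real.measurable_log.comp h.measurable

lemma measurable_pairKernel_right (z : Strip) : Measurable (pairKernel z) :=
  Measurable.of_uncurry_left (f := pairKernel) measurable_pairKernel

lemma pairKernel_comm (z ξ : Strip) : pairKernel z ξ = pairKernel ξ z := by
  rw [pairKernel, ← logKernel_neg, neg_sub, neg_sub, pairKernel]

lemma integrable_logKernel_sub (x : ℝ) (y : Torus) :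
    Integrable fun y' => logKernel x (y - y') :=
  Integrable.comp_sub_left (f := logKernel x) (integrable_logKernel x) y

lemma integral_logKernel_sub (x : ℝ) (y : Torus) :
    ∫ y', logKernel x (y - y') = 2 * π * (|x| - Real.log 2) :=
  (integral_sub_left_eq_self (logKernel x) volume y).trans (integral_logKernel x)

lemma integral_abs_logKernel_sub_le (x : ℝ) (y : Torus) :
    ∫ y', |logKernel x (y - y')| ≤ 2 * π * (|x| + 3) :=
  (integral_sub_left_eq_self (fun y => |logKernel x y|) volume y).trans_le
    (integral_abs_logKernel_le x)

lemma volume_prod_univ (I : Set ℝ) :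
    volume (I ×ˢ (Set.univ : Set Torus)) = volume I * ENNReal.ofReal (2 * π) := by
  rw [Measure.volume_eq_prod, Measure.prod_prod, AddCircle.measure_univ]

lemma restrict_prod_univ (I : Set ℝ) :
    (volume : Measure Strip).restrict (I ×ˢ (Set.univ : Set Torus))
      = (volume.restrict I).prod volume := by
  rw [Measure.volume_eq_prod, ← Measure.prod_restrict, Measure.restrict_univ]

lemma integrableOn_pairKernel {I : Set ℝ} (hI : MeasurableSet I) (hfin : volume I ≠ ∞)
    {R : ℝ} (z : Strip) (hR : ∀ t ∈ I, |z.1 - t| ≤ R) :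
    IntegrableOn (pairKernel z) (I ×ˢ (Set.univ : Set Torus)) := by
  have : IsFiniteMeasure (volume.restrict I) := ⟨by simpa using hfin.lt_top⟩
  have hm := measurable_pairKernel_right z
  rw [IntegrableOn, restrict_prod_univ, integrable_prod_iff hm.aestronglyMeasurable]
  refine ⟨.of_forall fun t => integrable_logKernel_sub (z.1 - t) z.2, ?_⟩
  have hm' : AEStronglyMeasurable (fun t => ∫ y, ‖pairKernel z (t, y)‖) (volume.restrict I) :=
    (hm.norm.aestronglyMeasurable (μ := (volume.restrict I).prod volume)).integral_prod_right'
  refine Integrable.of_bound hm' (2 * π * (R + 3)) ?_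
  filter_upwards [ae_restrict_mem hI] with t ht
  rw [Real.norm_of_nonneg (integral_nonneg fun _ => norm_nonneg _)]
  refine (integral_abs_logKernel_sub_le (z.1 - t) z.2).trans ?_
  have := hR t ht
  gcongr

lemma setIntegral_abs_pairKernel_le {I : Set ℝ} (hI : MeasurableSet I) (hfin : volume I ≠ ∞)
    {R : ℝ} (z : Strip) (hR : ∀ t ∈ I, |z.1 - t| ≤ R) :
    ∫ ξ in I ×ˢ (Set.univ : Set Torus), |pairKernel z ξ|
      ≤ 2 * π * (R + 3) * volume.real I := by
  have : IsFiniteMeasure (volume.restrict I) := ⟨by simpa using hfin.lt_top⟩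
  have h := (integrableOn_pairKernel hI hfin z hR).abs
  rw [restrict_prod_univ] at h ⊢
  rw [integral_prod _ h]
  have h1 : ∫ t in I, ∫ y : Torus, |pairKernel z (t, y)| ≤ ∫ _ in I, 2 * π * (R + 3) := by
    refine integral_mono_ae h.integral_prod_left (integrable_const _) ?_
    filter_upwards [ae_restrict_mem hI] with t ht
    refine (integral_abs_logKernel_sub_le (z.1 - t) z.2).trans ?_
    have := hR t ht
    gcongr
  refine h1.trans_eq ?_
  rw [setIntegral_const, smul_eq_mul, mul_comm]

/-- The potential generated by the strip `[-L, L] × 𝕋`. -/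
def stripPotential (L x : ℝ) : ℝ := ∫ t in Set.Icc (-L) L, 2 * π * (|x - t| - Real.log 2)

lemma setIntegral_pairKernel (L : ℝ) (z : Strip) :
    ∫ ξ in Set.Icc (-L) L ×ˢ (Set.univ : Set Torus), pairKernel z ξ
      = stripPotential L z.1 := by
  have h := integrableOn_pairKernel (I := Set.Icc (-L) L) (R := |z.1| + |L|) measurableSet_Icc
    (by simp) z fun t ht => (abs_sub z.1 t).trans <| by
      have := abs_le.2 ⟨ht.1, ht.2⟩
      have := le_abs_self L
      linarith
  rw [IntegrableOn, restrict_prod_univ] at h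
  rw [restrict_prod_univ, integral_prod _ h]
  refine integral_congr_ae (.of_forall fun t => ?_)
  exact integral_logKernel_sub (z.1 - t) z.2

lemma abs_stripPotential_sub_le {L : ℝ} (hL : 0 ≤ L) (x x' : ℝ) :
    |stripPotential L x - stripPotential L x'| ≤ 4 * π * L * |x - x'| := by
  have hint : ∀ x : ℝ, IntegrableOn (fun t => 2 * π * (|x - t| - Real.log 2))
      (Set.Icc (-L) L) := fun x =>
    ContinuousOn.integrableOn_compact isCompact_Icc (by fun_prop)
  rw [stripPotential, stripPotential, ← integral_sub (hint x) (hint x')]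
  have h := norm_setIntegral_le_of_norm_le_const (μ := volume) (s := Set.Icc (-L) L)
    (f := fun t => 2 * π * (|x - t| - Real.log 2) - 2 * π * (|x' - t| - Real.log 2))
    (C := 2 * π * |x - x'|) (by simp) fun t _ => by
      have h1 := abs_abs_sub_abs_le_abs_sub (x - t) (x' - t)
      rw [sub_sub_sub_cancel_right] at h1
      rw [← mul_sub, sub_sub_sub_cancel_right, Real.norm_eq_abs, abs_mul,
        abs_of_pos Real.two_pi_pos]
      gcongr
  rw [Real.volume_real_Icc_of_le (by linarith), Real.norm_eq_abs] at h
  linarith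

/-- Lebesgue measure on the truncated strip `[-R, R] × 𝕋`. -/
abbrev truncVolume (R : ℝ) : Measure Strip :=
  volume.restrict (Set.Icc (-R) R ×ˢ (Set.univ : Set Torus))

instance (R : ℝ) : IsFiniteMeasure (truncVolume R) :=
  ⟨by rw [Measure.restrict_apply_univ, volume_prod_univ]
      exact ENNReal.mul_lt_top (by simp) ENNReal.ofReal_lt_top⟩

lemma integrable_stripPotential {L : ℝ} (hL : 0 ≤ L) (R : ℝ) :
    Integrable (fun z : Strip => stripPotential L z.1) (truncVolume R) := by
  have hlip : LipschitzWith (Real.toNNReal (4 * π * L)) (stripPotential L) :=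
    LipschitzWith.of_dist_le' fun x x' => abs_stripPotential_sub_le hL x x'
  refine Integrable.of_bound
    (hlip.continuous.measurable.comp measurable_fst).aestronglyMeasurable
    (|stripPotential L 0| + 4 * π * L * R) ?_
  filter_upwards [ae_restrict_mem (measurableSet_Icc.prod .univ)] with z hz
  have h1 := abs_stripPotential_sub_le hL z.1 0
  have h2 : |z.1 - 0| ≤ R := by
    rw [sub_zero]
    exact abs_le.2 hz.1
  have h3 : 4 * π * L * |z.1 - 0| ≤ 4 * π * L * R := by gcongr
  have h4 := abs_sub_abs_le_abs_sub (stripPotential L z.1) (stripPotential L 0)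
  rw [Real.norm_eq_abs]
  linarith

lemma integrable_pairKernel (R : ℝ) :
    Integrable (fun p : Strip × Strip => pairKernel p.1 p.2)
      ((truncVolume R).prod (truncVolume R)) := by
  have hm := measurable_pairKernel
  have hR : ∀ z ∈ Set.Icc (-R) R ×ˢ (Set.univ : Set Torus), ∀ t ∈ Set.Icc (-R) R,
      |z.1 - t| ≤ 2 * R := fun z hz t ht => by
    have := hz.1.1
    have := hz.1.2
    exact abs_le.2 ⟨by linarith [ht.2], by linarith [ht.1]⟩
  have hB : MeasurableSet (Set.Icc (-R) R ×ˢ (Set.univ : Set Torus)) :=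
    measurableSet_Icc.prod .univ
  rw [integrable_prod_iff hm.aestronglyMeasurable]
  constructor
  · filter_upwards [ae_restrict_mem hB] with z hz
    exact integrableOn_pairKernel measurableSet_Icc (by simp) z (hR z hz)
  · refine Integrable.of_bound hm.norm.aestronglyMeasurable.integral_prod_right'
      (2 * π * (2 * R + 3) * volume.real (Set.Icc (-R) R)) ?_
    filter_upwards [ae_restrict_mem hB] with z hz
    rw [Real.norm_of_nonneg (integral_nonneg fun _ => norm_nonneg _)]
    exact setIntegral_abs_pairKernel_le measurableSet_Icc (by simp) z (hR z hz)

lemma integrable_mul_pairKernel (R : ℝ) {f g : Strip → ℝ} (hf : Measurable f) (hg : Measurable g)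
    (hf1 : ∀ z, |f z| ≤ 1) (hg1 : ∀ z, |g z| ≤ 1) :
    Integrable (fun p : Strip × Strip => f p.1 * g p.2 * pairKernel p.1 p.2)
      ((truncVolume R).prod (truncVolume R)) := by
  refine (integrable_pairKernel R).bdd_mul (c := 1)
    ((hf.comp measurable_fst).mul (hg.comp measurable_snd)).aestronglyMeasurable
    (.of_forall fun p => ?_)
  simpa [abs_mul] using mul_le_one₀ (hf1 p.1) (abs_nonneg _) (hg1 p.2)

lemma restrict_truncVolume {R : ℝ} {E : Set Strip} (hE : MeasurableSet E)
    (h : volume (E \ Set.Icc (-R) R ×ˢ (Set.univ : Set Torus)) = 0) :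
    (truncVolume R).restrict E = volume.restrict E := by
  rw [Measure.restrict_restrict hE]
  refine Measure.restrict_congr_set ?_
  rw [← Set.sdiff_sdiff_right_self]
  exact sdiff_null_ae_eq_self h

/-- The characteristic function of a subset of the strip. -/
def charFn (E : Set Strip) : Strip → ℝ := E.indicator fun _ => 1

lemma measurable_charFn {E : Set Strip} (hE : MeasurableSet E) : Measurable (charFn E) :=
  measurable_const.indicator hE

lemma charFn_of_mem {E : Set Strip} {z : Strip} (h : z ∈ E) : charFn E z = 1 :=
  Set.indicator_of_mem h _

lemma charFn_of_notMem {E : Set Strip} {z : Strip} (h : z ∉ E) : charFn E z = 0 :=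
  Set.indicator_of_notMem h _

lemma charFn_nonneg (E : Set Strip) (z : Strip) : 0 ≤ charFn E z :=
  Set.indicator_nonneg (fun _ _ => zero_le_one) z

lemma charFn_le_one (E : Set Strip) (z : Strip) : charFn E z ≤ 1 :=
  Set.indicator_le_self' (fun _ _ => zero_le_one) z

lemma abs_charFn_le_one (E : Set Strip) (z : Strip) : |charFn E z| ≤ 1 := by
  rw [abs_of_nonneg (charFn_nonneg E z)]
  exact charFn_le_one E z

lemma abs_charFn_sub_le_one (E E₀ : Set Strip) (z : Strip) :
    |charFn E z - charFn E₀ z| ≤ 1 :=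
  abs_le.2 ⟨by linarith [charFn_nonneg E z, charFn_le_one E₀ z],
    by linarith [charFn_nonneg E₀ z, charFn_le_one E z]⟩

lemma integral_charFn_mul {R : ℝ} {E : Set Strip} (hE : MeasurableSet E)
    (h : volume (E \ Set.Icc (-R) R ×ˢ (Set.univ : Set Torus)) = 0) (f : Strip → ℝ) :
    ∫ z, charFn E z * f z ∂(truncVolume R) = ∫ z in E, f z := by
  rw [← restrict_truncVolume hE h, ← integral_indicator hE]
  refine integral_congr_ae (.of_forall fun z => ?_)
  by_cases hz : z ∈ E <;> simp [charFn, hz]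

lemma integral_charFn {R : ℝ} {E : Set Strip} (hE : MeasurableSet E)
    (h : volume (E \ Set.Icc (-R) R ×ˢ (Set.univ : Set Torus)) = 0) :
    ∫ z, charFn E z ∂(truncVolume R) = volume.real E := by
  simpa using integral_charFn_mul hE h fun _ => 1

lemma Freg_eq_integral_prod {R : ℝ} {E : Set Strip} (hE : MeasurableSet E)
    (h : volume (E \ Set.Icc (-R) R ×ˢ (Set.univ : Set Torus)) = 0) :
    Freg E = ∫ p, charFn E p.1 * charFn E p.2 * pairKernel p.1 p.2
      ∂((truncVolume R).prod (truncVolume R)) := by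
  have hm := measurable_charFn hE
  rw [integral_prod _ (integrable_mul_pairKernel R hm hm (abs_charFn_le_one E)
    (abs_charFn_le_one E))]
  simp only [mul_assoc, integral_const_mul]
  rw [integral_charFn_mul hE h]
  refine integral_congr_ae (.of_forall fun z => ?_)
  exact (integral_charFn_mul hE h (pairKernel z)).symm

/-- Expansion of the energy around a reference set, with the linear term written through the
potential of the reference set. -/
lemma Freg_sub_Freg {R : ℝ} {E E₀ : Set Strip} (hE : MeasurableSet E) (hE₀ : MeasurableSet E₀)
    (h : volume (E \ Set.Icc (-R) R ×ˢ (Set.univ : Set Torus)) = 0)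
    (h₀ : volume (E₀ \ Set.Icc (-R) R ×ˢ (Set.univ : Set Torus)) = 0) :
    Freg E - Freg E₀
      = 2 * ∫ z, (charFn E z - charFn E₀ z) * (∫ ξ in E₀, pairKernel z ξ) ∂(truncVolume R)
        + ∫ z, (charFn E z - charFn E₀ z)
            * (∫ ξ, (charFn E ξ - charFn E₀ ξ) * pairKernel z ξ ∂(truncVolume R))
          ∂(truncVolume R) := by
  have hu := measurable_charFn hE
  have hv := measurable_charFn hE₀
  set g : Strip → ℝ := fun z => charFn E z - charFn E₀ z with hgdef
  have hg : Measurable g := hu.sub hv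
  have hg1 : ∀ z, |g z| ≤ 1 := abs_charFn_sub_le_one E E₀
  have hv1 := abs_charFn_le_one E₀
  have igv := integrable_mul_pairKernel R hg hv hg1 hv1
  have ivg := integrable_mul_pairKernel R hv hg hv1 hg1
  have igg := integrable_mul_pairKernel R hg hg hg1 hg1
  have ivv := integrable_mul_pairKernel R hv hv hv1 hv1
  have hswap := integral_prod_swap (μ := truncVolume R) (ν := truncVolume R)
    fun p : Strip × Strip => g p.1 * charFn E₀ p.2 * pairKernel p.1 p.2
  have hcomm : ∫ p, charFn E₀ p.1 * g p.2 * pairKernel p.1 p.2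
        ∂((truncVolume R).prod (truncVolume R))
      = ∫ p, g p.1 * charFn E₀ p.2 * pairKernel p.1 p.2
        ∂((truncVolume R).prod (truncVolume R)) := by
    rw [← hswap]
    refine integral_congr_ae (.of_forall fun p => ?_)
    simp only [Prod.fst_swap, Prod.snd_swap]
    rw [pairKernel_comm p.2 p.1, mul_comm (g p.2)]
  have hexp : Freg E = ∫ p, (charFn E₀ p.1 * charFn E₀ p.2 * pairKernel p.1 p.2
        + g p.1 * charFn E₀ p.2 * pairKernel p.1 p.2)
        + (charFn E₀ p.1 * g p.2 * pairKernel p.1 p.2 + g p.1 * g p.2 * pairKernel p.1 p.2)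
        ∂((truncVolume R).prod (truncVolume R)) := by
    rw [Freg_eq_integral_prod hE h]
    refine integral_congr_ae (.of_forall fun p => ?_)
    simp only [hgdef]
    ring
  have ivv_igv : Integrable (fun p : Strip × Strip =>
      charFn E₀ p.1 * charFn E₀ p.2 * pairKernel p.1 p.2
        + g p.1 * charFn E₀ p.2 * pairKernel p.1 p.2)
      ((truncVolume R).prod (truncVolume R)) := ivv.add igv
  have ivg_igg : Integrable (fun p : Strip × Strip =>
      charFn E₀ p.1 * g p.2 * pairKernel p.1 p.2 + g p.1 * g p.2 * pairKernel p.1 p.2)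
      ((truncVolume R).prod (truncVolume R)) := ivg.add igg
  rw [integral_add ivv_igv ivg_igg, integral_add ivv igv, integral_add ivg igg, hcomm,
    ← Freg_eq_integral_prod hE₀ h₀, integral_prod _ igv, integral_prod _ igg] at hexp
  simp only [mul_assoc, integral_const_mul, integral_charFn_mul hE₀ h₀] at hexp
  rw [hexp]
  ring

lemma abs_integral_mul_le_integral {R : ℝ} {J : Set ℝ} (hJ : MeasurableSet J)
    (hJR : J ⊆ Set.Icc (-R) R) {g : Strip → ℝ} (hg1 : ∀ z, |g z| ≤ 1)
    (hg0 : ∀ᵐ z : Strip, z.1 ∉ J → g z = 0) {f b : Strip → ℝ}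
    (hb : IntegrableOn b (J ×ˢ (Set.univ : Set Torus)))
    (hf : ∀ z : Strip, z.1 ∈ J → |f z| ≤ b z) :
    |∫ z, g z * f z ∂(truncVolume R)| ≤ ∫ z in J ×ˢ (Set.univ : Set Torus), b z := by
  have hJm : MeasurableSet (J ×ˢ (Set.univ : Set Torus)) := hJ.prod .univ
  have hsub : J ×ˢ (Set.univ : Set Torus) ⊆ Set.Icc (-R) R ×ˢ Set.univ :=
    Set.prod_mono_left hJR
  have h0 : volume (J ×ˢ (Set.univ : Set Torus) \ Set.Icc (-R) R ×ˢ Set.univ) = 0 := by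
    rw [Set.sdiff_eq_empty.2 hsub, measure_empty]
  have hb' := hb
  rw [IntegrableOn, ← restrict_truncVolume hJm h0, ← IntegrableOn,
    ← integrable_indicator_iff hJm] at hb'
  rw [← restrict_truncVolume hJm h0, ← integral_indicator hJm, ← Real.norm_eq_abs]
  refine norm_integral_le_of_norm_le hb' ?_
  filter_upwards [ae_restrict_of_ae hg0] with z hz
  by_cases hzJ : z.1 ∈ J
  · rw [Set.indicator_of_mem (Set.mk_mem_prod hzJ (Set.mem_univ z.2)), norm_mul]
    exact (mul_le_of_le_one_left (norm_nonneg _) (hg1 z)).trans (hf z hzJ)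
  · rw [hz hzJ, zero_mul, norm_zero, Set.indicator_of_notMem fun hmem => hzJ hmem.1]

lemma abs_integral_mul_le {R M : ℝ} {J : Set ℝ} (hJ : MeasurableSet J)
    (hJR : J ⊆ Set.Icc (-R) R) {g : Strip → ℝ} (hg1 : ∀ z, |g z| ≤ 1)
    (hg0 : ∀ᵐ z : Strip, z.1 ∉ J → g z = 0) {f : Strip → ℝ}
    (hf : ∀ z : Strip, z.1 ∈ J → |f z| ≤ M) :
    |∫ z, g z * f z ∂(truncVolume R)| ≤ 2 * π * M * volume.real J := by
  have hfin : volume (J ×ˢ (Set.univ : Set Torus)) ≠ ∞ := by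
    rw [volume_prod_univ]
    exact ENNReal.mul_ne_top (measure_ne_top_of_subset hJR (by simp)) ENNReal.ofReal_ne_top
  refine (abs_integral_mul_le_integral hJ hJR hg1 hg0 (b := fun _ => M)
    (integrableOn_const hfin) hf).trans_eq ?_
  rw [setIntegral_const, measureReal_def, volume_prod_univ, ENNReal.toReal_mul,
    ENNReal.toReal_ofReal (by positivity), measureReal_def, smul_eq_mul]
  ring

/-- The quadratic term in the expansion of the energy. -/
lemma abs_integral_integral_pairKernel_le {R : ℝ} {J : Set ℝ} (hJ : MeasurableSet J)
    (hJR : J ⊆ Set.Icc (-R) R) {g : Strip → ℝ} (hg1 : ∀ z, |g z| ≤ 1)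
    (hg0 : ∀ᵐ z : Strip, z.1 ∉ J → g z = 0) :
    |∫ z, g z * (∫ ξ, g ξ * pairKernel z ξ ∂(truncVolume R)) ∂(truncVolume R)|
      ≤ 4 * π ^ 2 * (2 * R + 3) * volume.real J ^ 2 := by
  have hfin : volume J ≠ ∞ := measure_ne_top_of_subset hJR (by simp)
  refine (abs_integral_mul_le hJ hJR hg1 hg0
    (M := 2 * π * (2 * R + 3) * volume.real J) fun z hz => ?_).trans_eq (by ring)
  have hdist : ∀ t ∈ J, |z.1 - t| ≤ 2 * R := fun t ht => by
    have h1 := hJR hz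
    have h2 := hJR ht
    exact abs_le.2 ⟨by linarith [h1.1, h2.2], by linarith [h1.2, h2.1]⟩
  exact (abs_integral_mul_le_integral hJ hJR hg1 hg0
    (integrableOn_pairKernel hJ hfin z hdist).abs fun _ _ => le_rfl).trans
    (setIntegral_abs_pairKernel_le hJ hfin z hdist)

lemma volume_real_prod_univ (I : Set ℝ) :
    volume.real (I ×ˢ (Set.univ : Set Torus)) = 2 * π * volume.real I := by
  rw [measureReal_def, volume_prod_univ, ENNReal.toReal_mul,
    ENNReal.toReal_ofReal (by positivity), measureReal_def, mul_comm]

/-- A charge with zero total mass and zero mass on the right half does not see potentials that are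
constant on each half of the strip. -/
lemma integral_charFn_sub_mul_ite {R : ℝ} {E E₀ : Set Strip} (hE : MeasurableSet E)
    (hE₀ : MeasurableSet E₀)
    (h : volume (E \ Set.Icc (-R) R ×ˢ (Set.univ : Set Torus)) = 0)
    (h₀ : volume (E₀ \ Set.Icc (-R) R ×ˢ (Set.univ : Set Torus)) = 0)
    (hvol : volume.real E = volume.real E₀)
    (hpos : volume.real (E ∩ {z | 0 < z.1}) = volume.real (E₀ ∩ {z | 0 < z.1})) (a b : ℝ) :
    ∫ z, (charFn E z - charFn E₀ z) * (if 0 < z.1 then a else b) ∂(truncVolume R) = 0 := by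
  have hP : MeasurableSet {z : Strip | 0 < z.1} := measurableSet_lt measurable_const measurable_fst
  have hint : ∀ {A : Set Strip}, MeasurableSet A → Integrable (charFn A) (truncVolume R) :=
    fun hA => .of_bound (measurable_charFn hA).aestronglyMeasurable 1
      (.of_forall (abs_charFn_le_one _))
  have hnull : ∀ {A : Set Strip}, volume (A \ Set.Icc (-R) R ×ˢ (Set.univ : Set Torus)) = 0 →
      volume ((A ∩ {z | 0 < z.1}) \ Set.Icc (-R) R ×ˢ (Set.univ : Set Torus)) = 0 := fun hA =>
    measure_mono_null (Set.sdiff_subset_sdiff_left Set.inter_subset_left) hA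
  have hsplit : ∀ z : Strip, (charFn E z - charFn E₀ z) * (if 0 < z.1 then a else b)
      = (a - b) * (charFn (E ∩ {z | 0 < z.1}) z - charFn (E₀ ∩ {z | 0 < z.1}) z)
        + b * (charFn E z - charFn E₀ z) := fun z => by
    by_cases hz : 0 < z.1 <;> by_cases h1 : z ∈ E <;> by_cases h2 : z ∈ E₀ <;>
      simp [charFn, hz, h1, h2] <;> ring
  simp only [hsplit]
  have hi1 : Integrable (fun z =>
      (a - b) * (charFn (E ∩ {z | 0 < z.1}) z - charFn (E₀ ∩ {z | 0 < z.1}) z)) (truncVolume R) :=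
    ((hint (hE.inter hP)).sub (hint (hE₀.inter hP))).const_mul _
  have hi2 : Integrable (fun z => b * (charFn E z - charFn E₀ z)) (truncVolume R) :=
    ((hint hE).sub (hint hE₀)).const_mul _
  rw [integral_add hi1 hi2, integral_const_mul, integral_const_mul,
    integral_sub (hint (hE.inter hP)) (hint (hE₀.inter hP)), integral_sub (hint hE) (hint hE₀),
    integral_charFn (hE.inter hP) (hnull h), integral_charFn (hE₀.inter hP) (hnull h₀),
    integral_charFn hE h, integral_charFn hE₀ h₀, hvol, hpos]
  ring

/-- There exist `C > 0` and `L₀ > 2` such that for `L > L₀`, `ε ∈ (0,1)`,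
and any measurable `E ⊆ S`, centered around the origin, with `|E| = 4πL` and
`((-(L-ε),L-ε) × 𝕋) ⊆ E ⊆ ((-(L+ε),L+ε) × 𝕋)` up to null sets, one has
`|F(χ_E) - F(χ_{E₀})| ≤ C·L·ε²` with `E₀ = [-L,L] × 𝕋`. -/
theorem stmt_7 :
    ∃ C > (0 : ℝ), ∃ L₀ > (2 : ℝ), ∀ L > L₀, ∀ ε : ℝ, 0 < ε → ε < 1 →
      ∀ E : Set Strip, MeasurableSet E →
      volume E = ENNReal.ofReal (4 * π * L) →
      volume (E ∩ {z : Strip | 0 < z.1}) = volume E / 2 →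
      volume (E ∩ {z : Strip | z.1 < 0}) = volume E / 2 →
      volume ((Set.Ioo (-(L - ε)) (L - ε) ×ˢ (Set.univ : Set Torus)) \ E) = 0 →
      volume (E \ (Set.Ioo (-(L + ε)) (L + ε) ×ˢ (Set.univ : Set Torus))) = 0 →
      |Freg E - Freg (Set.Icc (-L) L ×ˢ (Set.univ : Set Torus))| ≤ C * L * ε ^ 2 := by
  refine ⟨1000 * π ^ 2, by positivity, 3, by norm_num, ?_⟩
  intro L hL ε hε0 hε1 E hE hvol hpos _ hinner houter
  have hE₀ : MeasurableSet (Set.Icc (-L) L ×ˢ (Set.univ : Set Torus)) :=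
    measurableSet_Icc.prod .univ
  set E₀ := Set.Icc (-L) L ×ˢ (Set.univ : Set Torus) with hE₀def
  have h : volume (E \ Set.Icc (-(L + 1)) (L + 1) ×ˢ (Set.univ : Set Torus)) = 0 :=
    measure_mono_null (Set.sdiff_subset_sdiff_right <| Set.prod_mono_left fun t ht =>
      ⟨by linarith [ht.1], by linarith [ht.2]⟩) houter
  have h₀ : volume (E₀ \ Set.Icc (-(L + 1)) (L + 1) ×ˢ (Set.univ : Set Torus)) = 0 := by
    rw [Set.sdiff_eq_empty.2 (Set.prod_mono_left
      (Set.Icc_subset_Icc (by linarith) (by linarith))), measure_empty]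
  have hvolE : volume.real E = 4 * π * L := by
    rw [measureReal_def, hvol, ENNReal.toReal_ofReal (by positivity)]
  have hvolE₀ : volume.real E₀ = 4 * π * L := by
    rw [volume_real_prod_univ, Real.volume_real_Icc_of_le (by linarith)]
    ring
  have hposE : volume.real (E ∩ {z | 0 < z.1}) = 2 * π * L := by
    rw [measureReal_def, hpos, ENNReal.toReal_div, ← measureReal_def, hvolE, ENNReal.toReal_ofNat]
    ring
  have hposE₀ : volume.real (E₀ ∩ {z | 0 < z.1}) = 2 * π * L := by
    have hset : E₀ ∩ {z | 0 < z.1} = Set.Ioc 0 L ×ˢ (Set.univ : Set Torus) := by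
      ext z
      simp only [hE₀def, Set.mem_inter_iff, Set.mem_prod, Set.mem_Icc, Set.mem_univ, and_true,
        Set.mem_ofPred_eq, Set.mem_Ioc]
      exact ⟨fun hz => ⟨hz.2, hz.1.2⟩, fun hz => ⟨⟨by linarith [hz.1], hz.2⟩, hz.1⟩⟩
    rw [hset, volume_real_prod_univ, Real.volume_real_Ioc_of_le (by linarith), sub_zero]
  set J := Set.Icc (L - ε) (L + ε) ∪ Set.Icc (-(L + ε)) (-(L - ε)) with hJdef
  have hJ : MeasurableSet J := measurableSet_Icc.union measurableSet_Icc
  have hJR : J ⊆ Set.Icc (-(L + 1)) (L + 1) := by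
    rintro t (ht | ht) <;> exact ⟨by linarith [ht.1], by linarith [ht.2]⟩
  have hJvol : volume.real J ≤ 4 * ε := by
    refine (measureReal_union_le _ _).trans_eq ?_
    rw [Real.volume_real_Icc_of_le (by linarith), Real.volume_real_Icc_of_le (by linarith)]
    ring
  have hg1 := abs_charFn_sub_le_one E E₀
  have hg0 : ∀ᵐ z : Strip, z.1 ∉ J → charFn E z - charFn E₀ z = 0 := by
    filter_upwards [measure_eq_zero_iff_ae_notMem.1 hinner,
      measure_eq_zero_iff_ae_notMem.1 houter] with z hz1 hz2 hzJ
    by_cases hin : z.1 ∈ Set.Ioo (-(L - ε)) (L - ε)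
    · have hzE : z ∈ E := by
        by_contra hc
        exact hz1 ⟨⟨hin, Set.mem_univ _⟩, hc⟩
      have hzE₀ : z ∈ E₀ := ⟨⟨by linarith [hin.1], by linarith [hin.2]⟩, Set.mem_univ _⟩
      rw [charFn_of_mem hzE, charFn_of_mem hzE₀, sub_self]
    · have hout : z.1 ∉ Set.Icc (-(L + ε)) (L + ε) := fun hc => by
        rcases le_or_gt (L - ε) z.1 with h1 | h1
        · exact hzJ (.inl ⟨h1, hc.2⟩)
        · exact hzJ (.inr ⟨hc.1, not_lt.1 fun h2 => hin ⟨h2, h1⟩⟩)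
      have hzE : z ∉ E := fun hc =>
        hz2 ⟨hc, fun hmem => hout (Set.Ioo_subset_Icc_self hmem.1)⟩
      have hzE₀ : z ∉ E₀ := fun hc =>
        hout ⟨by linarith [hc.1.1], by linarith [hc.1.2]⟩
      rw [charFn_of_notMem hzE, charFn_of_notMem hzE₀, sub_self]
  have hlin : |∫ z, (charFn E z - charFn E₀ z) * (∫ ξ in E₀, pairKernel z ξ)
      ∂(truncVolume (L + 1))| ≤ 2 * π * (4 * π * L * ε) * volume.real J := by
    set c : Strip → ℝ := fun z =>
      if 0 < z.1 then stripPotential L L else stripPotential L (-L) with hc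
    have hcm : Measurable c :=
      Measurable.ite (measurableSet_lt measurable_const measurable_fst) measurable_const
        measurable_const
    have hzero := integral_charFn_sub_mul_ite hE hE₀ h h₀ (hvolE.trans hvolE₀.symm)
      (hposE.trans hposE₀.symm) (stripPotential L L) (stripPotential L (-L))
    have hcint : Integrable (fun z => (charFn E z - charFn E₀ z) * c z) (truncVolume (L + 1)) := by
      refine Integrable.bdd_mul (c := 1) (.of_bound hcm.aestronglyMeasurable
        (|stripPotential L L| + |stripPotential L (-L)|) (.of_forall fun z => ?_))
        ((measurable_charFn hE).sub (measurable_charFn hE₀)).aestronglyMeasurable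
        (.of_forall hg1)
      simp only [hc]
      split_ifs
      · exact le_add_of_nonneg_right (abs_nonneg _)
      · exact le_add_of_nonneg_left (abs_nonneg _)
    have hVint : Integrable (fun z => (charFn E z - charFn E₀ z) * stripPotential L z.1)
        (truncVolume (L + 1)) :=
      (integrable_stripPotential (by linarith) (L + 1)).bdd_mul (c := 1)
        ((measurable_charFn hE).sub (measurable_charFn hE₀)).aestronglyMeasurable
        (.of_forall hg1)
    have hsub : ∫ z, (charFn E z - charFn E₀ z) * (∫ ξ in E₀, pairKernel z ξ)
        ∂(truncVolume (L + 1)) = ∫ z, (charFn E z - charFn E₀ z) * (stripPotential L z.1 - c z)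
        ∂(truncVolume (L + 1)) := by
      simp only [hE₀def, setIntegral_pairKernel, mul_sub]
      rw [integral_sub hVint hcint, hzero, sub_zero]
    rw [hsub]
    refine abs_integral_mul_le hJ hJR hg1 hg0 fun z hz => ?_
    simp only [hc]
    split_ifs with hz0
    · refine (abs_stripPotential_sub_le (by linarith) _ _).trans ?_
      have : |z.1 - L| ≤ ε := by
        rcases hz with hz | hz
        · exact abs_le.2 ⟨by linarith [hz.1], by linarith [hz.2]⟩
        · linarith [hz.2]
      gcongr
    · refine (abs_stripPotential_sub_le (by linarith) _ _).trans ?_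
      have : |z.1 - -L| ≤ ε := by
        rcases hz with hz | hz
        · linarith [hz.1]
        · exact abs_le.2 ⟨by linarith [hz.1], by linarith [hz.2]⟩
      gcongr
  have hquad := abs_integral_integral_pairKernel_le hJ hJR hg1 hg0
  rw [Freg_sub_Freg hE hE₀ h h₀]
  refine (abs_add_le _ _).trans ?_
  rw [abs_mul, abs_two]
  have hlin' : 2 * π * (4 * π * L * ε) * volume.real J ≤ 2 * π * (4 * π * L * ε) * (4 * ε) := by
    gcongr
  have hquad' : 4 * π ^ 2 * (2 * (L + 1) + 3) * volume.real J ^ 2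
      ≤ 4 * π ^ 2 * (5 * L) * (4 * ε) ^ 2 := by
    gcongr
    linarith
  have hnn : 0 ≤ π ^ 2 * L * ε ^ 2 := by positivity
  nlinarith [hlin.trans hlin', hquad.trans hquad']
end
end

section
/- If the set 𝒪 is nonempty, then the variational problem inf_{ρ ∈ 𝒪} Φ(ρ) has a minimizer: there exists ρ* ∈ 𝒪 such that Φ(ρ*) ≤ Φ(ρ) for every ρ ∈ 𝒪. -/
open MeasureTheory

/-- Densities with values in `[0, 1]` whose mass in the `j`-th bin `(jδ, (j+1)δ]` is `r j`. -/
structure IsBinnedDensity (δ : ℝ) (r : ℕ → ℝ) (f : ℝ → ℝ) : Prop where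
  measurable : Measurable f
  mem_Icc : ∀ x, f x ∈ Set.Icc (0 : ℝ) 1
  integral_eq : ∀ j : ℕ, ∫ x in Set.Ioc ((j : ℝ) * δ) (((j : ℝ) + 1) * δ), f x = r j

lemma iUnion_bins {δ : ℝ} (hδ : 0 < δ) :
    ⋃ j : ℕ, Set.Ioc ((j : ℝ) * δ) (((j : ℝ) + 1) * δ) = Set.Ioi 0 := by
  ext x
  simp only [Set.mem_iUnion, Set.mem_Ioc, Set.mem_Ioi]
  constructor
  · rintro ⟨j, h, -⟩
    exact lt_of_le_of_lt (by positivity) h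
  · intro hx
    have hpos : 0 < ⌈x / δ⌉₊ := Nat.ceil_pos.2 (div_pos hx hδ)
    refine ⟨⌈x / δ⌉₊ - 1, ?_, ?_⟩
    · rw [← lt_div_iff₀ hδ]
      exact Nat.lt_ceil.1 (by omega)
    · rw [← div_le_iff₀ hδ]
      have h := Nat.le_ceil (x / δ)
      have h2 : ((⌈x / δ⌉₊ - 1 : ℕ) : ℝ) + 1 = ⌈x / δ⌉₊ := by
        exact_mod_cast Nat.sub_add_cancel hpos
      rwa [h2]

lemma pairwise_disjoint_bins {δ : ℝ} (hδ : 0 < δ) :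
    Pairwise (Function.onFun Disjoint
      fun j : ℕ => Set.Ioc ((j : ℝ) * δ) (((j : ℝ) + 1) * δ)) := by
  have hm : Monotone fun j : ℕ => (j : ℝ) * δ := fun a b h => by
    dsimp only
    gcongr
  simpa using hm.pairwise_disjoint_on_Ioc_succ

lemma hasSum_integral_bins {δ : ℝ} (hδ : 0 < δ) {f : ℝ → ℝ}
    (hf : IntegrableOn f (Set.Ioi 0)) :
    HasSum (fun j : ℕ => ∫ x in Set.Ioc ((j : ℝ) * δ) (((j : ℝ) + 1) * δ), f x)
      (∫ x in Set.Ioi 0, f x) := by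
  have h := hasSum_integral_iUnion (f := f) (μ := volume) (fun j : ℕ => measurableSet_Ioc)
    (pairwise_disjoint_bins hδ) (by rwa [iUnion_bins hδ])
  rwa [iUnion_bins hδ] at h

/-- The density which fills each bin from its left end. -/
noncomputable def leftPacked (δ : ℝ) (r : ℕ → ℝ) : ℝ → ℝ :=
  (⋃ j : ℕ, Set.Ioc ((j : ℝ) * δ) ((j : ℝ) * δ + r j)).indicator 1

lemma measurable_leftPacked (δ : ℝ) (r : ℕ → ℝ) : Measurable (leftPacked δ r) :=
  measurable_one.indicator (MeasurableSet.iUnion fun _ => measurableSet_Ioc)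

lemma leftPacked_mem_Icc (δ : ℝ) (r : ℕ → ℝ) (x : ℝ) :
    leftPacked δ r x ∈ Set.Icc (0 : ℝ) 1 := by
  unfold leftPacked
  by_cases hx : x ∈ ⋃ j : ℕ, Set.Ioc ((j : ℝ) * δ) ((j : ℝ) * δ + r j) <;> simp [hx]

lemma leftPacked_of_nonpos {δ : ℝ} (hδ : 0 < δ) (r : ℕ → ℝ) {x : ℝ} (hx : x ≤ 0) :
    leftPacked δ r x = 0 := by
  refine Set.indicator_of_notMem ?_ _
  simp only [Set.mem_iUnion, Set.mem_Ioc, not_exists, not_and]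
  intro j hj
  have : 0 ≤ (j : ℝ) * δ := by positivity
  linarith

lemma leftPacked_of_mem_bin {δ : ℝ} (hδ : 0 < δ) {r : ℕ → ℝ} (hr : ∀ j, r j ≤ δ) {x : ℝ}
    {i : ℕ} (hx : x ∈ Set.Ioc ((i : ℝ) * δ) (((i : ℝ) + 1) * δ)) :
    leftPacked δ r x =
      (Set.Ioc ((i : ℝ) * δ) ((i : ℝ) * δ + r i)).indicator (1 : ℝ → ℝ) x := by
  unfold leftPacked
  by_cases h : x ∈ Set.Ioc ((i : ℝ) * δ) ((i : ℝ) * δ + r i)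
  · rw [Set.indicator_of_mem h, Set.indicator_of_mem (Set.mem_iUnion.2 ⟨i, h⟩)]
  · rw [Set.indicator_of_notMem h, Set.indicator_of_notMem]
    simp only [Set.mem_iUnion, not_exists]
    intro j hj
    have hj' : x ∈ Set.Ioc ((j : ℝ) * δ) (((j : ℝ) + 1) * δ) :=
      ⟨hj.1, hj.2.trans (by linarith [hr j])⟩
    have hij : i = j := by
      by_contra hne
      exact Set.disjoint_left.1 (pairwise_disjoint_bins hδ hne) hx hj'
    exact h (hij ▸ hj)

/-- The density on the line obtained by packing mass towards the origin in each bin. -/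
noncomputable def originPacked (δ : ℝ) (r s : ℕ → ℝ) (x : ℝ) : ℝ :=
  leftPacked δ r x + leftPacked δ s (-x)

lemma originPacked_neg (δ : ℝ) (r s : ℕ → ℝ) (x : ℝ) :
    originPacked δ r s (-x) = originPacked δ s r x := by
  simp [originPacked, add_comm]

lemma originPacked_of_mem_bin {δ : ℝ} (hδ : 0 < δ) {r : ℕ → ℝ} (s : ℕ → ℝ)
    (hr : ∀ j, r j ≤ δ) {x : ℝ} {i : ℕ}
    (hx : x ∈ Set.Ioc ((i : ℝ) * δ) (((i : ℝ) + 1) * δ)) :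
    originPacked δ r s x =
      (Set.Ioc ((i : ℝ) * δ) ((i : ℝ) * δ + r i)).indicator (1 : ℝ → ℝ) x := by
  have hx0 : 0 ≤ x := le_trans (by positivity) hx.1.le
  rw [originPacked, leftPacked_of_nonpos hδ s (by linarith : -x ≤ 0), add_zero,
    leftPacked_of_mem_bin hδ hr hx]

lemma isBinnedDensity_originPacked {δ : ℝ} (hδ : 0 < δ) {r : ℕ → ℝ} (s : ℕ → ℝ)
    (hr0 : ∀ j, 0 ≤ r j) (hr : ∀ j, r j ≤ δ) : IsBinnedDensity δ r (originPacked δ r s) where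
  measurable :=
    (measurable_leftPacked δ r).add ((measurable_leftPacked δ s).comp measurable_neg)
  mem_Icc x := by
    unfold originPacked
    rcases le_total x 0 with hx | hx
    · rw [leftPacked_of_nonpos hδ r hx, zero_add]
      exact leftPacked_mem_Icc δ s _
    · rw [leftPacked_of_nonpos hδ s (by linarith : -x ≤ 0), add_zero]
      exact leftPacked_mem_Icc δ r _
  integral_eq j := by
    rw [setIntegral_congr_fun measurableSet_Ioc fun x hx => originPacked_of_mem_bin hδ s hr hx,
      setIntegral_indicator measurableSet_Ioc, Set.inter_eq_right.2
        (Set.Ioc_subset_Ioc_right (by linarith [hr j]))]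
    simp [hr0 j]

namespace IsBinnedDensity

variable {δ : ℝ} {r s : ℕ → ℝ} {f : ℝ → ℝ}

lemma integrableOn_Ioc (hf : IsBinnedDensity δ r f) (a b : ℝ) :
    IntegrableOn f (Set.Ioc a b) := by
  refine Measure.integrableOn_of_bounded (M := 1) (by simp) hf.measurable.aestronglyMeasurable ?_
  refine Filter.Eventually.of_forall fun x => ?_
  rw [Real.norm_of_nonneg (hf.mem_Icc x).1]
  exact (hf.mem_Icc x).2

lemma le_binWidth (hf : IsBinnedDensity δ r f) (hδ : 0 < δ) (j : ℕ) : r j ≤ δ := by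
  rw [← hf.integral_eq j]
  calc _ ≤ ∫ x in Set.Ioc ((j : ℝ) * δ) (((j : ℝ) + 1) * δ), (1 : ℝ) :=
        setIntegral_mono (hf.integrableOn_Ioc _ _) (by simp) fun x => (hf.mem_Icc x).2
    _ = δ := by
        have : ((j : ℝ) + 1) * δ - j * δ = δ := by ring
        simp [this, hδ.le]

lemma integrableOn_Ioi_moment (hf : IsBinnedDensity δ r f) (hδ : 0 < δ) (hr : Summable r)
    (hmom : Summable fun j : ℕ => (j : ℝ) * r j) :
    IntegrableOn (fun x => (1 + |x|) * f x) (Set.Ioi 0) := by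
  have hbound : ∀ j : ℕ, ∀ x ∈ Set.Ioc ((j : ℝ) * δ) (((j : ℝ) + 1) * δ),
      ‖(1 + |x|) * f x‖ ≤ (1 + ((j : ℝ) + 1) * δ) * f x := by
    intro j x hx
    have hx0 : 0 ≤ x := le_trans (by positivity) hx.1.le
    have hfx := (hf.mem_Icc x).1
    rw [Real.norm_of_nonneg (by positivity), abs_of_nonneg hx0]
    gcongr
    exact hx.2
  have hmeas : Measurable fun x => (1 + |x|) * f x :=
    (measurable_const.add measurable_norm).mul hf.measurable
  have hint : ∀ j : ℕ, IntegrableOn (fun x => (1 + |x|) * f x)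
      (Set.Ioc ((j : ℝ) * δ) (((j : ℝ) + 1) * δ)) := fun j =>
    Integrable.mono' ((hf.integrableOn_Ioc _ _).const_mul _) hmeas.aestronglyMeasurable
      ((ae_restrict_iff' measurableSet_Ioc).2 (Filter.Eventually.of_forall (hbound j)))
  rw [← iUnion_bins hδ]
  refine integrableOn_iUnion_of_summable_integral_norm hint ?_
  refine Summable.of_nonneg_of_le (fun j => integral_nonneg fun x => norm_nonneg _)
    (fun j => ?_) ((hr.mul_left (1 + δ)).add (hmom.mul_left δ))
  calc _ ≤ ∫ x in Set.Ioc ((j : ℝ) * δ) (((j : ℝ) + 1) * δ), (1 + ((j : ℝ) + 1) * δ) * f x :=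
        setIntegral_mono_on (hint j).norm ((hf.integrableOn_Ioc _ _).const_mul _)
          measurableSet_Ioc (hbound j)
    _ = _ := by
        rw [integral_const_mul, hf.integral_eq]
        ring

lemma integrable_moment (hf : IsBinnedDensity δ r f) (hf' : IsBinnedDensity δ s fun x => f (-x))
    (hδ : 0 < δ) (hr : Summable r) (hrmom : Summable fun j : ℕ => (j : ℝ) * r j)
    (hs : Summable s) (hsmom : Summable fun j : ℕ => (j : ℝ) * s j) :
    Integrable fun x => (1 + |x|) * f x := by
  have h₁ := hf.integrableOn_Ioi_moment hδ hr hrmom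
  have h₂ := (hf'.integrableOn_Ioi_moment hδ hs hsmom).comp_neg
  simp only [abs_neg, neg_neg, Set.neg_Ioi, neg_zero] at h₂
  rw [← integrableOn_univ, ← Set.Iic_union_Ioi (a := (0 : ℝ))]
  exact ((integrableOn_Iic_iff_integrableOn_Iio).2 h₂).union h₁

lemma integral_Ioi (hf : IsBinnedDensity δ r f) (hδ : 0 < δ) {m : ℝ} (hr : HasSum r m)
    (hint : IntegrableOn f (Set.Ioi 0)) : ∫ x in Set.Ioi 0, f x = m := by
  have h := hasSum_integral_bins hδ hint
  simp only [hf.integral_eq] at h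
  exact h.unique hr

end IsBinnedDensity

lemma setIntegral_sub_indicator_mul_nonneg {a b c : ℝ} {f V : ℝ → ℝ} (hac : a ≤ c) (hcb : c ≤ b)
    (hf : ∀ x, f x ∈ Set.Icc (0 : ℝ) 1) (hfi : IntegrableOn f (Set.Ioc a b))
    (hmass : ∫ x in Set.Ioc a b, f x = c - a) (hV : MonotoneOn V (Set.Icc a b))
    (hint : IntegrableOn (fun x => (f x - (Set.Ioc a c).indicator 1 x) * V x) (Set.Ioc a b)) :
    0 ≤ ∫ x in Set.Ioc a b, (f x - (Set.Ioc a c).indicator 1 x) * V x := by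
  have hi : IntegrableOn ((Set.Ioc a c).indicator (1 : ℝ → ℝ)) (Set.Ioc a b) :=
    (integrableOn_const (C := (1 : ℝ)) (by simp)).indicator measurableSet_Ioc
  have hzero : ∫ x in Set.Ioc a b, (f x - (Set.Ioc a c).indicator (1 : ℝ → ℝ) x) = 0 := by
    rw [integral_sub hfi hi, hmass, setIntegral_indicator measurableSet_Ioc,
      Set.inter_eq_right.2 (Set.Ioc_subset_Ioc_right hcb)]
    simp [hac]
  have hshift : ∫ x in Set.Ioc a b, (f x - (Set.Ioc a c).indicator 1 x) * (V x - V c) =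
      ∫ x in Set.Ioc a b, (f x - (Set.Ioc a c).indicator 1 x) * V x := by
    simp only [mul_sub]
    have hi' : IntegrableOn (fun x => (f x - (Set.Ioc a c).indicator 1 x) * V c) (Set.Ioc a b) :=
      (hfi.sub hi).mul_const _
    rw [integral_sub hint hi', integral_mul_const, hzero, zero_mul, sub_zero]
  rw [← hshift]
  refine setIntegral_nonneg measurableSet_Ioc fun x hx => ?_
  have hx' : x ∈ Set.Icc a b := Set.Ioc_subset_Icc_self hx
  by_cases hxc : x ≤ c
  · rw [Set.indicator_of_mem (show x ∈ Set.Ioc a c from ⟨hx.1, hxc⟩)]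
    exact mul_nonneg_of_nonpos_of_nonpos (sub_nonpos.2 (hf x).2)
      (sub_nonpos.2 (hV hx' ⟨hac, hcb⟩ hxc))
  · rw [Set.indicator_of_notMem fun h => hxc h.2, sub_zero]
    exact mul_nonneg (hf x).1 (sub_nonneg.2 (hV ⟨hac, hcb⟩ hx' (not_le.1 hxc).le))

lemma IsBinnedDensity.setIntegral_Ioi_sub_mul_nonneg {δ : ℝ} {r : ℕ → ℝ} {f V : ℝ → ℝ}
    (hf : IsBinnedDensity δ r f) (hδ : 0 < δ) (s : ℕ → ℝ) (hr : ∀ j, 0 ≤ r j)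
    (hV : MonotoneOn V (Set.Ici 0))
    (hint : IntegrableOn (fun x => (f x - originPacked δ r s x) * V x) (Set.Ioi 0)) :
    0 ≤ ∫ x in Set.Ioi 0, (f x - originPacked δ r s x) * V x := by
  refine (hasSum_integral_bins hδ hint).nonneg fun j => ?_
  have hw := hf.le_binWidth hδ
  have hsub : Set.Ioc ((j : ℝ) * δ) (((j : ℝ) + 1) * δ) ⊆ Set.Ioi 0 := by
    rw [← iUnion_bins hδ]
    exact Set.subset_iUnion (fun j : ℕ => Set.Ioc ((j : ℝ) * δ) (((j : ℝ) + 1) * δ)) j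
  have heq : Set.EqOn (fun x => (f x - originPacked δ r s x) * V x)
      (fun x => (f x - (Set.Ioc ((j : ℝ) * δ) (j * δ + r j)).indicator 1 x) * V x)
      (Set.Ioc ((j : ℝ) * δ) (((j : ℝ) + 1) * δ)) := fun x hx => by
    simp only [originPacked_of_mem_bin hδ s hw hx]
  rw [setIntegral_congr_fun measurableSet_Ioc heq]
  refine setIntegral_sub_indicator_mul_nonneg (by linarith [hr j]) (by linarith [hw j])
    hf.mem_Icc (hf.integrableOn_Ioc _ _) ?_ (hV.mono fun x hx => ?_)
    ((hint.mono_set hsub).congr_fun heq measurableSet_Ioc)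
  · rw [hf.integral_eq]
    ring
  · exact le_trans (show (0 : ℝ) ≤ (j : ℝ) * δ by positivity) hx.1

lemma Integrable.of_moment {f : ℝ → ℝ} (hf : Measurable f)
    (h : Integrable fun x => (1 + |x|) * f x) : Integrable f := by
  refine h.mono hf.aestronglyMeasurable (Filter.Eventually.of_forall fun x => ?_)
  rw [norm_mul, Real.norm_of_nonneg (by positivity : 0 ≤ 1 + |x|)]
  exact le_mul_of_one_le_left (norm_nonneg _) (by linarith [abs_nonneg x])

lemma integrable_abs_sub_mul {f : ℝ → ℝ} (hf : Measurable f)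
    (h : Integrable fun x => (1 + |x|) * f x) (a : ℝ) :
    Integrable fun y => |a - y| * f y := by
  refine (h.const_mul (1 + |a|)).mono
    ((measurable_const.sub measurable_id).norm.mul hf).aestronglyMeasurable
    (Filter.Eventually.of_forall fun y => ?_)
  rw [← mul_assoc, norm_mul, norm_mul _ (f y)]
  gcongr
  rw [Real.norm_of_nonneg (abs_nonneg _), Real.norm_of_nonneg (by positivity)]
  nlinarith [abs_sub a y, abs_nonneg a, abs_nonneg y]

/-- The potential of a density is monotone to the right of one of its medians. -/
lemma monotoneOn_potential {f : ℝ → ℝ} (hf : Measurable f) (hf0 : ∀ x, 0 ≤ f x)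
    (h : Integrable fun x => (1 + |x|) * f x)
    (hmass : ∫ x in Set.Ioi 0, f x = ∫ x in Set.Iic 0, f x) :
    MonotoneOn (fun x => ∫ y, |x - y| * f y) (Set.Ici 0) := by
  intro a ha b _ hab
  have hfi := Integrable.of_moment hf h
  have hI := integrable_abs_sub_mul hf h
  have hd : Integrable fun y => |b - y| * f y - |a - y| * f y := (hI b).sub (hI a)
  dsimp only
  rw [← sub_nonneg, ← integral_sub (hI b) (hI a),
    ← integral_add_compl measurableSet_Iic hd, Set.compl_Iic]
  have h₁ : (b - a) * ∫ y in Set.Iic 0, f y ≤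
      ∫ y in Set.Iic 0, (|b - y| * f y - |a - y| * f y) := by
    rw [← integral_const_mul]
    refine setIntegral_mono_on (hfi.integrableOn.const_mul _)
      hd.integrableOn measurableSet_Iic fun y hy => ?_
    have hy' : y ≤ 0 := hy
    have ha' : 0 ≤ a := ha
    rw [abs_of_nonneg (by linarith : 0 ≤ b - y), abs_of_nonneg (by linarith : 0 ≤ a - y)]
    exact le_of_eq (by ring)
  have h₂ : -(b - a) * ∫ y in Set.Ioi 0, f y ≤
      ∫ y in Set.Ioi 0, (|b - y| * f y - |a - y| * f y) := by
    rw [← integral_const_mul]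
    refine setIntegral_mono_on (hfi.integrableOn.const_mul _)
      hd.integrableOn measurableSet_Ioi fun y _ => ?_
    rw [← sub_mul]
    refine mul_le_mul_of_nonneg_right ?_ (hf0 y)
    have := abs_sub_le a b y
    rw [abs_sub_comm a b, abs_of_nonneg (sub_nonneg.2 hab)] at this
    linarith
  rw [hmass] at h₂
  linarith

lemma integrable_prod_abs_sub_mul {f g : ℝ → ℝ} (hf : Measurable f) (hg : Measurable g)
    (hfi : Integrable fun x => (1 + |x|) * f x) (hgi : Integrable fun x => (1 + |x|) * g x) :
    Integrable (fun p : ℝ × ℝ => |p.1 - p.2| * f p.1 * g p.2) (volume.prod volume) := by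
  refine (hfi.mul_prod hgi).mono ((((measurable_fst.sub measurable_snd).norm.mul
    (hf.comp measurable_fst)).mul (hg.comp measurable_snd)).aestronglyMeasurable)
    (Filter.Eventually.of_forall fun p => ?_)
  have key : ‖|p.1 - p.2|‖ ≤ ‖(1 + |p.1|) * (1 + |p.2|)‖ := by
    rw [Real.norm_of_nonneg (abs_nonneg _), Real.norm_of_nonneg (by positivity)]
    nlinarith [abs_sub p.1 p.2, abs_nonneg p.1, abs_nonneg p.2]
  calc ‖|p.1 - p.2| * f p.1 * g p.2‖ = ‖|p.1 - p.2|‖ * ‖f p.1 * g p.2‖ := by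
        rw [mul_assoc, norm_mul]
    _ ≤ ‖(1 + |p.1|) * (1 + |p.2|)‖ * ‖f p.1 * g p.2‖ := by gcongr
    _ = _ := by
        rw [← norm_mul]
        congr 1
        ring

/-- Polarisation: the difference of two interaction energies as the integral of the difference of
the densities against the potential of their sum. -/
lemma energy_sub_energy {f g : ℝ → ℝ} (hf : Measurable f) (hg : Measurable g)
    (hfi : Integrable fun x => (1 + |x|) * f x) (hgi : Integrable fun x => (1 + |x|) * g x) :
    Integrable (fun x => (f x - g x) * ∫ y, |x - y| * (f y + g y)) ∧
    (∫ x, ∫ y, |x - y| * f x * f y) - (∫ x, ∫ y, |x - y| * g x * g y) =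
      ∫ x, (f x - g x) * ∫ y, |x - y| * (f y + g y) := by
  have hff := integrable_prod_abs_sub_mul hf hf hfi hfi
  have hfg := integrable_prod_abs_sub_mul hf hg hfi hgi
  have hgf := integrable_prod_abs_sub_mul hg hf hgi hfi
  have hgg := integrable_prod_abs_sub_mul hg hg hgi hgi
  have heq : ∀ x, ((f x - g x) * ∫ y, |x - y| * (f y + g y)) =
      ∫ y, ((|x - y| * f x * f y - |x - y| * g x * g y) +
        (|x - y| * f x * g y - |x - y| * g x * f y)) := fun x => by
    rw [← integral_const_mul]
    congr 1
    ext y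
    ring
  have hsymm : ∫ p : ℝ × ℝ, |p.1 - p.2| * f p.1 * g p.2 =
      ∫ p : ℝ × ℝ, |p.1 - p.2| * g p.1 * f p.2 := by
    rw [Measure.volume_eq_prod, ← integral_prod_swap]
    congr 1
    ext p
    simp only [Prod.fst_swap, Prod.snd_swap]
    rw [abs_sub_comm]
    ring
  simp_rw [heq]
  have hall := (hff.sub hgg).add (hfg.sub hgf)
  refine ⟨hall.integral_prod_left, ?_⟩
  have hprod := integral_prod _ hall
  have h₁ := integral_add (hff.sub hgg) (hfg.sub hgf)
  have h₂ := integral_sub hff hgg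
  have h₃ := integral_sub hfg hgf
  have h₄ := integral_prod _ hff
  have h₅ := integral_prod _ hgg
  rw [Measure.volume_eq_prod] at hsymm
  simp only [Pi.add_apply, Pi.sub_apply] at hprod h₁ h₂ h₃ h₄ h₅
  rw [← hprod, h₁, h₂, h₃, hsymm, h₄, h₅]
  ring

lemma IsBinnedDensity.integral_Ioi_add {δ m : ℝ} {r : ℕ → ℝ} {f g : ℝ → ℝ}
    (hf : IsBinnedDensity δ r f) (hg : IsBinnedDensity δ r g) (hδ : 0 < δ) (hr : HasSum r m)
    (hfi : Integrable f) (hgi : Integrable g) :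
    ∫ x in Set.Ioi 0, (f x + g x) = m + m := by
  rw [integral_add hfi.integrableOn hgi.integrableOn, hf.integral_Ioi hδ hr hfi.integrableOn,
    hg.integral_Ioi hδ hr hgi.integrableOn]

lemma setIntegral_Iic_eq_Ioi_neg (f : ℝ → ℝ) :
    ∫ x in Set.Iic 0, f x = ∫ x in Set.Ioi 0, f (-x) := by
  simp

/-- Packing mass towards a common median decreases the interaction energy. -/
lemma energy_originPacked_le {δ m : ℝ} (hδ : 0 < δ) {r s : ℕ → ℝ} (hr0 : ∀ j, 0 ≤ r j)
    (hs0 : ∀ j, 0 ≤ s j) (hr : HasSum r m) (hs : HasSum s m)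
    (hrmom : Summable fun j : ℕ => (j : ℝ) * r j) (hsmom : Summable fun j : ℕ => (j : ℝ) * s j)
    {f : ℝ → ℝ} (hf : IsBinnedDensity δ r f) (hf' : IsBinnedDensity δ s fun x => f (-x)) :
    (∫ x, ∫ y, |x - y| * originPacked δ r s x * originPacked δ r s y) ≤
      ∫ x, ∫ y, |x - y| * f x * f y := by
  set g := originPacked δ r s with hg_def
  have hg : IsBinnedDensity δ r g :=
    isBinnedDensity_originPacked hδ s hr0 (hf.le_binWidth hδ)
  have hg' : IsBinnedDensity δ s fun x => g (-x) := by
    simp only [hg_def, originPacked_neg]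
    exact isBinnedDensity_originPacked hδ r hs0 (hf'.le_binWidth hδ)
  have hfm := hf.integrable_moment hf' hδ hr.summable hrmom hs.summable hsmom
  have hgm := hg.integrable_moment hg' hδ hr.summable hrmom hs.summable hsmom
  have hfi := Integrable.of_moment hf.measurable hfm
  have hgi := Integrable.of_moment hg.measurable hgm
  have hright := hf.integral_Ioi_add hg hδ hr hfi hgi
  have hleft := hf'.integral_Ioi_add hg' hδ hs hfi.comp_neg hgi.comp_neg
  have hsm : Measurable fun x => f x + g x := hf.measurable.add hg.measurable
  have hs_nonneg : ∀ x, 0 ≤ f x + g x := fun x => add_nonneg (hf.mem_Icc x).1 (hg.mem_Icc x).1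
  have hsi : Integrable fun x => (1 + |x|) * (f x + g x) := by
    simp only [mul_add]
    exact hfm.add hgm
  have hV := monotoneOn_potential hsm hs_nonneg hsi
    (by rw [setIntegral_Iic_eq_Ioi_neg, hright, hleft])
  have hV' : MonotoneOn (fun x => ∫ y, |-x - y| * (f y + g y)) (Set.Ici 0) := by
    have h := monotoneOn_potential (hsm.comp measurable_neg) (fun x => hs_nonneg (-x))
      (by simpa using hsi.comp_neg)
      (by simp only [setIntegral_Iic_eq_Ioi_neg, Function.comp_apply, neg_neg, hright, hleft])
    refine h.congr fun x _ => ?_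
    dsimp only
    rw [← integral_neg_eq_self]
    congr 1
    ext y
    rw [Function.comp_apply, neg_neg, ← abs_neg (x - -y)]
    congr 2
    ring
  obtain ⟨hint, heq⟩ := energy_sub_energy hf.measurable hg.measurable hfm hgm
  rw [← sub_nonneg, heq, ← integral_add_compl measurableSet_Iic hint, Set.compl_Iic,
    setIntegral_Iic_eq_Ioi_neg]
  refine add_nonneg ?_ (hf.setIntegral_Ioi_sub_mul_nonneg hδ s hr0 hV hint.integrableOn)
  have hint' := hint.comp_neg
  simp only [hg_def, originPacked_neg] at hint' hV' ⊢
  exact hf'.setIntegral_Ioi_sub_mul_nonneg hδ r hs0 hV' hint'.integrableOn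

lemma setIntegral_Ioc_comp_neg {a b : ℝ} (hab : a ≤ b) (f : ℝ → ℝ) :
    ∫ x in Set.Ioc a b, f (-x) = ∫ x in Set.Ioc (-b) (-a), f x := by
  rw [← intervalIntegral.integral_of_le hab, ← intervalIntegral.integral_of_le (neg_le_neg hab),
    intervalIntegral.integral_comp_neg]

/-- Admissibility expressed through the binned masses on the two half-lines. -/
lemma mem_admissible_iff {δ : ℝ} (hδ : 0 < δ) (ρp ρm : ℕ → ℝ) (ρ : ℝ → ℝ) :
    (Measurable ρ ∧ (∀ x, ρ x ∈ Set.Icc (0 : ℝ) 1) ∧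
        (∀ j : ℕ, ∫ x in Set.Ioc ((j : ℝ) * δ) (((j : ℝ) + 1) * δ), ρ x = ρp j) ∧
        (∀ j : ℕ, ∫ x in Set.Ioc (-(((j : ℝ) + 1) * δ)) (-((j : ℝ) * δ)), ρ x = ρm j)) ↔
      IsBinnedDensity δ ρp ρ ∧ IsBinnedDensity δ ρm fun x => ρ (-x) := by
  have hneg : ∀ j : ℕ, ∫ x in Set.Ioc ((j : ℝ) * δ) (((j : ℝ) + 1) * δ), ρ (-x) =
      ∫ x in Set.Ioc (-(((j : ℝ) + 1) * δ)) (-((j : ℝ) * δ)), ρ x := fun j =>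
    setIntegral_Ioc_comp_neg (by linarith) ρ
  constructor
  · rintro ⟨hm, hb, hp, hn⟩
    exact ⟨⟨hm, hb, hp⟩, ⟨hm.comp measurable_neg, fun x => hb (-x),
      fun j => (hneg j).trans (hn j)⟩⟩
  · rintro ⟨h, h'⟩
    exact ⟨h.measurable, h.mem_Icc, h.integral_eq,
      fun j => (hneg j).symm.trans (h'.integral_eq j)⟩

/-- If the set `𝒪` is nonempty, then the variational problem
`inf_{ρ ∈ 𝒪} Φ(ρ)` has a minimizer: there exists `ρ* ∈ 𝒪` with `Φ(ρ*) ≤ Φ(ρ)` for all `ρ ∈ 𝒪`.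
Here `Φ(ρ) = ∫∫ |x₁-x₂| ρ(x₁) ρ(x₂) dx₁ dx₂`, and `𝒪` is the set of measurable
`ρ : ℝ → [0,1]` with prescribed integrals `ρ_j⁺`, `ρ_j⁻` over `[jδ,(j+1)δ]`, `[-(j+1)δ,-jδ]`,
where `Σ ρ_j⁺ = Σ ρ_j⁻ = 1` and `Σ j ρ_j⁺ < ∞`, `Σ j ρ_j⁻ < ∞`. -/
theorem stmt_8 (δ : ℝ) (hδ : 0 < δ) (ρp ρm : ℕ → ℝ)
    (hρp : ∀ j, 0 ≤ ρp j) (hρm : ∀ j, 0 ≤ ρm j)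
    (hsump : HasSum ρp 1) (hsumm : HasSum ρm 1)
    (hmomp : Summable fun j : ℕ => (j : ℝ) * ρp j)
    (hmomm : Summable fun j : ℕ => (j : ℝ) * ρm j)
    (O : Set (ℝ → ℝ))
    (hO : O = {ρ | Measurable ρ ∧ (∀ x, ρ x ∈ Set.Icc (0 : ℝ) 1) ∧
        (∀ j : ℕ, ∫ x in Set.Ioc ((j : ℝ) * δ) (((j : ℝ) + 1) * δ), ρ x = ρp j) ∧
        (∀ j : ℕ, ∫ x in Set.Ioc (-(((j : ℝ) + 1) * δ)) (-((j : ℝ) * δ)), ρ x = ρm j)})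
    (hne : O.Nonempty) :
    ∃ ρs ∈ O, ∀ ρ ∈ O,
      (∫ x, ∫ y, |x - y| * ρs x * ρs y) ≤ ∫ x, ∫ y, |x - y| * ρ x * ρ y := by
  subst hO
  obtain ⟨ρ₀, hρ₀⟩ := hne
  obtain ⟨h₀, h₀'⟩ := (mem_admissible_iff hδ ρp ρm ρ₀).1 hρ₀
  refine ⟨originPacked δ ρp ρm, (mem_admissible_iff hδ ρp ρm _).2 ⟨?_, ?_⟩, fun ρ hρ => ?_⟩
  · exact isBinnedDensity_originPacked hδ ρm hρp (h₀.le_binWidth hδ)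
  · simp only [originPacked_neg]
    exact isBinnedDensity_originPacked hδ ρp hρm (h₀'.le_binWidth hδ)
  · obtain ⟨h, h'⟩ := (mem_admissible_iff hδ ρp ρm ρ).1 hρ
    exact energy_originPacked_le hδ hρp hρm hsump hsumm hmomp hmomm h h'
end
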